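/- arXiv:1304.7898 — 2 statements merged into one kernel-verified Lean document; each statement's English description precedes it below -/
import Mathlib

section
/- Let −1 < α < 0 and β > −2. Then there exist constants c, C > 0 such that for all w in the punctured unit disk D* ⊂ ℂ, c·(1−|w|²)^α ≤ ∫_{D*} (1−|η|²)^α |η|^β / |1 − w·conj(η)|² dV(η) ≤ C·(1−|w|²)^α, where dV is normalized area measure on the disk. -/
open MeasureTheory

lemma PD_ang (a : ℂ) (ha : ‖a‖ < 1) :
    ∫⁻ θ in Set.Ioo (-Real.pi) Real.pi,
      ENNReal.ofReal (1 / ‖(1 : ℂ) - a * (starRingEnd ℂ) (Real.cos θ + Real.sin θ * Complex.I)‖ ^ 2)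
      = ENNReal.ofReal (2 * Real.pi / (1 - ‖a‖ ^ 2)) := by
  have hpos : 0 < 1 - ‖a‖ ^ 2 := by nlinarith [norm_nonneg a]
  have hcirc : ∀ θ : ℝ, ((Real.cos θ : ℂ) + Real.sin θ * Complex.I) = circleMap 0 1 θ := by
    intro θ
    simp [circleMap, Complex.exp_mul_I]
  have hn : ∀ θ : ℝ, ‖circleMap 0 1 θ‖ = 1 := by intro θ; simp
  have hkey : ∀ θ : ℝ, ‖(1 : ℂ) - a * (starRingEnd ℂ) (circleMap 0 1 θ)‖
      = ‖circleMap 0 1 θ - a‖ := by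
    intro θ
    have h1 : (starRingEnd ℂ) (circleMap 0 1 θ) * circleMap 0 1 θ = 1 := by
      rw [Complex.conj_mul', hn]; simp
    have h2 : ((1 : ℂ) - a * (starRingEnd ℂ) (circleMap 0 1 θ)) * circleMap 0 1 θ
      = circleMap 0 1 θ - a := by
      linear_combination (-a) * h1
    rw [← h2, norm_mul, hn, mul_one]
  have hne : ∀ θ : ℝ, ‖circleMap 0 1 θ - a‖ ≠ 0 := by
    intro θ h
    rw [norm_eq_zero, sub_eq_zero] at h
    rw [← h, hn] at ha
    exact lt_irrefl _ ha
  simp_rw [hcirc, hkey]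
  have hcont : Continuous (fun θ : ℝ => 1 / ‖circleMap 0 1 θ - a‖ ^ 2) := by
    refine Continuous.div continuous_const (by fun_prop) ?_
    intro θ; exact pow_ne_zero _ (hne θ)
  rw [← ofReal_integral_eq_lintegral_ofReal]
  rotate_left
  · exact (hcont.integrableOn_Icc (a := -Real.pi) (b := Real.pi)).mono_set Set.Ioo_subset_Icc_self
  · exact Filter.Eventually.of_forall fun θ => by positivity
  congr 1
  have hP := DiffContOnCl.circleAverage_poissonKernel_smul (R := 1) (c := 0) (w := a)
    (f := fun _ => (1 : ℂ)) diffContOnCl_const (by simpa using ha)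
  have hP2 : ∫ θ in (0 : ℝ)..2 * Real.pi, (1 - ‖a‖ ^ 2) * (1 / ‖circleMap 0 1 θ - a‖ ^ 2)
      = 2 * Real.pi := by
    rw [Real.circleAverage_def] at hP
    simp only [Pi.smul_apply', poissonKernel_def, sub_zero, hn, Complex.real_smul, mul_one] at hP
    rw [intervalIntegral.integral_ofReal] at hP
    have hP' := congrArg Complex.re hP
    simp only [Complex.mul_re, Complex.ofReal_re, Complex.ofReal_im, Complex.one_re] at hP'
    rw [mul_zero, sub_zero] at hP'
    have hpi := Real.pi_pos
    have h3 : (∫ θ in (0 : ℝ)..2 * Real.pi, (1 ^ 2 - ‖a‖ ^ 2) / ‖circleMap 0 1 θ - a‖ ^ 2)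
      = 2 * Real.pi := by
      field_simp at hP'
      linarith
    rw [← h3]
    congr 1
    ext θ
    ring
  rw [intervalIntegral.integral_const_mul] at hP2
  have hper : Function.Periodic (fun θ : ℝ => 1 / ‖circleMap 0 1 θ - a‖ ^ 2) (2 * Real.pi) := by
    intro θ
    simp only [periodic_circleMap 0 1 θ]
  have h4 := hper.intervalIntegral_add_eq (-Real.pi) 0
  rw [← integral_Ioc_eq_integral_Ioo, ← intervalIntegral.integral_of_le (by linarith [Real.pi_pos])]
  rw [show -Real.pi + 2 * Real.pi = Real.pi by ring, zero_add] at h4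
  rw [h4, eq_div_iff hpos.ne', mul_comm]
  exact hP2

lemma PD_rpow (γ b : ℝ) (hγ : -1 < γ) (hb : 0 ≤ b) :
    ∫⁻ u in Set.Ioc 0 b, ENNReal.ofReal (u ^ γ) = ENNReal.ofReal (b ^ (γ + 1) / (γ + 1)) := by
  rw [← ofReal_integral_eq_lintegral_ofReal]
  · rw [← intervalIntegral.integral_of_le hb, integral_rpow (Or.inl hγ),
      Real.zero_rpow (by linarith), sub_zero]
  · exact (intervalIntegrable_iff_integrableOn_Ioc_of_le hb).1
      (intervalIntegral.intervalIntegrable_rpow' hγ)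
  · exact (ae_restrict_iff' measurableSet_Ioc).2
      (Filter.Eventually.of_forall fun u hu => Real.rpow_nonneg hu.1.le _)

lemma PD_rpow2 (α ε : ℝ) (hα : α < 0) (he : 0 < ε) (he1 : ε ≤ 1) :
    ∫⁻ u in Set.Ioc ε 1, ENNReal.ofReal (u ^ (α - 1)) ≤ ENNReal.ofReal (ε ^ α / (-α)) := by
  have h0 : (0 : ℝ) ∉ Set.uIcc ε 1 := by
    rw [Set.uIcc_of_le he1]; intro h; linarith [h.1]
  rw [← ofReal_integral_eq_lintegral_ofReal]
  · rw [← intervalIntegral.integral_of_le he1,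
      integral_rpow (Or.inr ⟨by linarith, h0⟩)]
    apply ENNReal.ofReal_le_ofReal
    rw [sub_add_cancel, Real.one_rpow, div_neg, ← neg_div, div_le_div_right_of_neg hα]
    linarith
  · exact (intervalIntegrable_iff_integrableOn_Ioc_of_le he1).1
      (intervalIntegral.intervalIntegrable_rpow (Or.inr h0))
  · exact (ae_restrict_iff' measurableSet_Ioc).2
      (Filter.Eventually.of_forall fun u hu => Real.rpow_nonneg (he.trans hu.1).le _)

lemma PD_J (α ε : ℝ) (hα1 : -1 < α) (hα : α < 0) (he : 0 < ε) (he1 : ε ≤ 1) :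
    ∫⁻ r in Set.Ioo (0 : ℝ) 1, ENNReal.ofReal ((1 - r) ^ α / max (1 - r) ε)
      ≤ ENNReal.ofReal (ε ^ α * (1 / (α + 1) + 1 / (-α))) := by
  have hm : Measurable (fun u : ℝ => ENNReal.ofReal (u ^ α / max u ε)) := by fun_prop
  have h := (volume.measurePreserving_sub_left (1 : ℝ)).setLIntegral_comp_preimage
    (s := Set.Ioo 0 1) measurableSet_Ioo hm
  have hpre : (fun x : ℝ => 1 - x) ⁻¹' Set.Ioo 0 1 = Set.Ioo 0 1 := by
    ext x; simp only [Set.mem_preimage, Set.mem_Ioo]; constructor <;> rintro ⟨_, _⟩ <;> constructor <;> linarith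
  rw [hpre] at h
  rw [h]
  have hsub : Set.Ioo (0 : ℝ) 1 ⊆ Set.Ioc 0 ε ∪ Set.Ioc ε 1 := by
    intro x hx
    rcases le_or_gt x ε with h | h
    · exact Or.inl ⟨hx.1, h⟩
    · exact Or.inr ⟨h, hx.2.le⟩
  refine (lintegral_mono_set hsub).trans ((lintegral_union_le _ _ _).trans ?_)
  have e1 : ∫⁻ u in Set.Ioc 0 ε, ENNReal.ofReal (u ^ α / max u ε)
      ≤ ENNReal.ofReal (ε ^ α * (1 / (α + 1))) := by
    calc _ ≤ ∫⁻ u in Set.Ioc 0 ε, ENNReal.ofReal (1 / ε) * ENNReal.ofReal (u ^ α) := by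
          apply setLIntegral_mono' measurableSet_Ioc
          intro u hu
          rw [max_eq_right hu.2, ← ENNReal.ofReal_mul (by positivity)]
          apply le_of_eq; congr 1; ring
      _ = ENNReal.ofReal (ε ^ α * (1 / (α + 1))) := by
          rw [lintegral_const_mul _ (by fun_prop), PD_rpow α ε hα1 he.le,
            ← ENNReal.ofReal_mul (by positivity), Real.rpow_add_one he.ne']
          congr 1
          field_simp
  have e2 : ∫⁻ u in Set.Ioc ε 1, ENNReal.ofReal (u ^ α / max u ε)
      ≤ ENNReal.ofReal (ε ^ α * (1 / (-α))) := by
    rw [mul_one_div]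
    refine le_trans ?_ (PD_rpow2 α ε hα he he1)
    apply setLIntegral_mono' measurableSet_Ioc
    intro u hu
    rw [max_eq_left hu.1.le, Real.rpow_sub_one (he.trans hu.1).ne']
  refine (add_le_add e1 e2).trans ?_
  have : 0 < 1 / (α + 1) := by apply one_div_pos.2; linarith
  have : 0 < 1 / (-α) := by apply one_div_pos.2; linarith
  rw [← ENNReal.ofReal_add (by positivity) (by positivity), mul_add]

lemma PD_pt_upper (α β ε r : ℝ) (hα : α < 0) (he : 0 < ε) (he1 : ε ≤ 1)
    (hr : 0 < r) (hr1 : r < 1) :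
    r ^ (β + 1) * (1 - r ^ 2) ^ α / (1 - (1 - ε) * r ^ 2) ≤
      ((3 / 4 : ℝ) ^ α * (4 / 3)) * r ^ (β + 1)
        + (1 + (1 / 2 : ℝ) ^ (β + 1)) * ((1 - r) ^ α / max (1 - r) ε) := by
  have hu : 0 < 1 - r := by linarith
  have ht : 0 < 1 - r ^ 2 := by nlinarith
  have hd1 : 1 - r ^ 2 ≤ 1 - (1 - ε) * r ^ 2 := by nlinarith [mul_pos he (pow_pos hr 2)]
  have hd2 : ε ≤ 1 - (1 - ε) * r ^ 2 := by nlinarith [mul_nonneg (sub_nonneg.2 he1) ht.le]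
  have hd : 0 < 1 - (1 - ε) * r ^ 2 := by linarith
  have hp : 0 < r ^ (β + 1) := Real.rpow_pos_of_pos hr _
  have hq : 0 < (1 / 2 : ℝ) ^ (β + 1) := by positivity
  have hmax : 0 < max (1 - r) ε := lt_max_of_lt_left hu
  rcases le_or_gt r (1 / 2) with h | h
  · have h1 : (1 - r ^ 2) ^ α ≤ (3 / 4 : ℝ) ^ α :=
      Real.rpow_le_rpow_of_nonpos (by norm_num) (by nlinarith) hα.le
    have h2 : r ^ (β + 1) * (1 - r ^ 2) ^ α / (1 - (1 - ε) * r ^ 2)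
        ≤ r ^ (β + 1) * (3 / 4 : ℝ) ^ α / (3 / 4) := by
      apply div_le_div₀ (by positivity) (by gcongr) (by norm_num) (by nlinarith)
    have h3 : 0 ≤ (1 + (1 / 2 : ℝ) ^ (β + 1)) * ((1 - r) ^ α / max (1 - r) ε) := by positivity
    have h4 : r ^ (β + 1) * (3 / 4 : ℝ) ^ α / (3 / 4)
      = ((3 / 4 : ℝ) ^ α * (4 / 3)) * r ^ (β + 1) := by ring
    linarith
  · have h1 : (1 - r ^ 2) ^ α ≤ (1 - r) ^ α :=
      Real.rpow_le_rpow_of_nonpos hu (by nlinarith) hα.le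
    have h2 : r ^ (β + 1) ≤ 1 + (1 / 2 : ℝ) ^ (β + 1) := by
      rcases le_or_gt 0 (β + 1) with hb | hb
      · have := Real.rpow_le_one hr.le hr1.le hb
        linarith
      · have := Real.rpow_le_rpow_of_nonpos (by norm_num) h.le hb.le
        linarith
    have h3 : max (1 - r) ε ≤ 1 - (1 - ε) * r ^ 2 := max_le (by nlinarith) hd2
    have h4 : r ^ (β + 1) * (1 - r ^ 2) ^ α / (1 - (1 - ε) * r ^ 2) ≤
        (1 + (1 / 2 : ℝ) ^ (β + 1)) * (1 - r) ^ α / max (1 - r) ε := by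
      apply div_le_div₀ (by positivity) _ hmax h3
      apply mul_le_mul h2 h1 (by positivity) (by positivity)
    have h5 : 0 ≤ ((3 / 4 : ℝ) ^ α * (4 / 3)) * r ^ (β + 1) := by positivity
    rw [mul_div_assoc] at h4 ⊢
    rw [mul_div_assoc] at h4
    linarith

lemma PD_pt_lower (α β ε r : ℝ) (hα : α < 0) (he : 0 < ε) (he1 : ε ≤ 1)
    (hr : 1 - ε / 2 < r) (hr1 : r < 1) :
    min 1 ((1 / 2 : ℝ) ^ (β + 1)) * ε ^ α / (2 * ε) ≤
    r ^ (β + 1) * (1 - r ^ 2) ^ α / (1 - (1 - ε) * r ^ 2) := by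
  have hr0 : 1 / 2 < r := by linarith
  have ht : 0 < 1 - r ^ 2 := by nlinarith
  have hd2 : ε ≤ 1 - (1 - ε) * r ^ 2 := by nlinarith [mul_nonneg (sub_nonneg.2 he1) ht.le]
  have hp : 0 < r ^ (β + 1) := Real.rpow_pos_of_pos (by linarith) _
  have h1 : ε ^ α ≤ (1 - r ^ 2) ^ α :=
    Real.rpow_le_rpow_of_nonpos ht (by nlinarith) hα.le
  have h2 : min 1 ((1 / 2 : ℝ) ^ (β + 1)) ≤ r ^ (β + 1) := by
    rcases le_or_gt 0 (β + 1) with hb | hb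
    · exact (min_le_right _ _).trans (Real.rpow_le_rpow (by norm_num) hr0.le hb)
    · exact (min_le_left _ _).trans
        (Real.one_le_rpow_of_pos_of_le_one_of_nonpos (by linarith) hr1.le hb.le)
  apply div_le_div₀ (by positivity) _ (by linarith) (by nlinarith [mul_pos he ht])
  exact mul_le_mul h2 h1 (by positivity) hp.le

lemma PD_meas : MeasurableSet {η : ℂ | η ≠ 0 ∧ ‖η‖ < 1} := by measurability

lemma PD_polar (α β : ℝ) (w : ℂ) (hw : ‖w‖ < 1) :
    ∫⁻ η in {η : ℂ | η ≠ 0 ∧ ‖η‖ < 1},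
      ENNReal.ofReal ((1 - ‖η‖ ^ 2) ^ α * ‖η‖ ^ β / ‖(1 : ℂ) - w * (starRingEnd ℂ) η‖ ^ 2)
    = ENNReal.ofReal (2 * Real.pi) * ∫⁻ r in Set.Ioo (0 : ℝ) 1,
      ENNReal.ofReal (r ^ (β + 1) * (1 - r ^ 2) ^ α / (1 - ‖w‖ ^ 2 * r ^ 2)) := by
  have hS : MeasurableSet {η : ℂ | η ≠ 0 ∧ ‖η‖ < 1} := PD_meas
  rw [← lintegral_indicator hS, ← Complex.lintegral_comp_polarCoord_symm]
  have ht : polarCoord.target = Set.Ioi (0 : ℝ) ×ˢ Set.Ioo (-Real.pi) Real.pi := rfl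
  rw [ht, Measure.volume_eq_prod, ← Measure.prod_restrict, lintegral_prod]
  rotate_left
  · apply Measurable.aemeasurable
    have h1 : Measurable (fun p : ℝ × ℝ => Complex.polarCoord.symm p) := by
      simp_rw [Complex.polarCoord_symm_apply]
      fun_prop
    have h2 : Measurable ({η : ℂ | η ≠ 0 ∧ ‖η‖ < 1}.indicator fun η : ℂ => 
       ENNReal.ofReal ((1 - ‖η‖ ^ 2) ^ α * ‖η‖ ^ β / ‖(1 : ℂ) - w * (starRingEnd ℂ) η‖ ^ 2)) := by
      apply Measurable.indicator _ hS
      have : Measurable (starRingEnd ℂ) := Complex.continuous_conj.measurable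
      fun_prop
    exact (ENNReal.measurable_ofReal.comp measurable_fst).smul (h2.comp h1)
  have hsub : Set.Ioo (0 : ℝ) 1 ⊆ Set.Ioi 0 := fun x hx => hx.1
  rw [← lintegral_const_mul' _ _ ENNReal.ofReal_ne_top, ← lintegral_indicator measurableSet_Ioi,
    ← lintegral_indicator measurableSet_Ioo]
  congr 1
  ext r
  by_cases hr : 0 < r
  swap
  · rw [Set.indicator_of_notMem (by simpa using hr), Set.indicator_of_notMem (fun h => hr h.1)]
  rw [Set.indicator_of_mem (show r ∈ Set.Ioi 0 from hr)]
  have hnorm : ∀ θ : ℝ, ‖Complex.polarCoord.symm (r, θ)‖ = r := by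
    intro θ; rw [Complex.norm_polarCoord_symm, abs_of_pos hr]
  by_cases hr1 : r < 1
  swap
  · rw [Set.indicator_of_notMem (fun h => hr1 h.2)]
    have : ∀ θ : ℝ, Complex.polarCoord.symm (r, θ) ∉ {η : ℂ | η ≠ 0 ∧ ‖η‖ < 1} := by
      intro θ h
      have := h.2
      rw [hnorm] at this
      exact hr1 this
    simp only [Set.indicator_of_notMem (this _), smul_zero, lintegral_zero]
  rw [Set.indicator_of_mem (show r ∈ Set.Ioo 0 1 from ⟨hr, hr1⟩)]
  have hmem : ∀ θ : ℝ, Complex.polarCoord.symm (r, θ) ∈ {η : ℂ | η ≠ 0 ∧ ‖η‖ < 1} := by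
    intro θ
    refine ⟨?_, by rw [hnorm]; exact hr1⟩
    rw [← norm_pos_iff, hnorm]; exact hr
  simp only [Set.indicator_of_mem (hmem _), hnorm, smul_eq_mul]
  have hwr : ‖w * (r : ℂ)‖ = ‖w‖ * r := by
    rw [norm_mul, Complex.norm_real, Real.norm_of_nonneg hr.le]
  have hwr1 : ‖w * (r : ℂ)‖ < 1 := by rw [hwr]; nlinarith [norm_nonneg w]
  have hA : 0 ≤ r ^ (β + 1) * (1 - r ^ 2) ^ α :=
    mul_nonneg (Real.rpow_nonneg hr.le _) (Real.rpow_nonneg (by nlinarith) _)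
  have hstep : ∀ θ : ℝ, ENNReal.ofReal r * ENNReal.ofReal ((1 - r ^ 2) ^ α * r ^ β /
      ‖(1 : ℂ) - w * (starRingEnd ℂ) (Complex.polarCoord.symm (r, θ))‖ ^ 2)
      = ENNReal.ofReal (r ^ (β + 1) * (1 - r ^ 2) ^ α) * ENNReal.ofReal (1 / ‖(1 : ℂ) -
        (w * r) * (starRingEnd ℂ) (Real.cos θ + Real.sin θ * Complex.I)‖ ^ 2) := by
    intro θ
    rw [← ENNReal.ofReal_mul hr.le, ← ENNReal.ofReal_mul hA, Complex.polarCoord_symm_apply,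
      map_mul, Complex.conj_ofReal, ← mul_assoc w, Real.rpow_add_one hr.ne']
    congr 1
    ring
  simp only [hstep]
  rw [lintegral_const_mul' _ _ ENNReal.ofReal_ne_top, PD_ang _ hwr1, hwr,
    ← ENNReal.ofReal_mul hA, ← ENNReal.ofReal_mul (by positivity)]
  congr 1
  ring

theorem integral_punctured_disk_kernel_estimate (α β : ℝ)
    (hα₁ : -1 < α) (hα₂ : α < 0) (hβ : -2 < β) :
    ∃ c C : ℝ, 0 < c ∧ 0 < C ∧
      ∀ w : ℂ, w ≠ 0 → ‖w‖ < 1 →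
        c * (1 - ‖w‖ ^ 2) ^ α ≤
          (∫ η in {η : ℂ | η ≠ 0 ∧ ‖η‖ < 1},
            (1 - ‖η‖ ^ 2) ^ α * ‖η‖ ^ β / ‖(1 : ℂ) - w * (starRingEnd ℂ) η‖ ^ 2
            ∂((ENNReal.ofReal Real.pi)⁻¹ • volume)) ∧
        (∫ η in {η : ℂ | η ≠ 0 ∧ ‖η‖ < 1},
            (1 - ‖η‖ ^ 2) ^ α * ‖η‖ ^ β / ‖(1 : ℂ) - w * (starRingEnd ℂ) η‖ ^ 2
            ∂((ENNReal.ofReal Real.pi)⁻¹ • volume)) ≤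
          C * (1 - ‖w‖ ^ 2) ^ α := by
  have hpi := Real.pi_pos
  have hα3 : 0 < 1 / (α + 1) := by apply one_div_pos.2; linarith
  have hα4 : 0 < 1 / (-α) := by apply one_div_pos.2; linarith
  have hβ3 : 0 < 1 / (β + 2) := by apply one_div_pos.2; linarith
  set K1 : ℝ := (3 / 4 : ℝ) ^ α * (4 / 3) with hK1
  set K2 : ℝ := 1 + (1 / 2 : ℝ) ^ (β + 1) with hK2
  set k : ℝ := min 1 ((1 / 2 : ℝ) ^ (β + 1)) with hk
  have hK1p : 0 < K1 := by positivity
  have hK2p : 0 < K2 := by positivity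
  have hkp : 0 < k := by positivity
  set M : ℝ := K1 * (1 / (β + 2)) + K2 * (1 / (α + 1) + 1 / (-α)) with hM
  have hMp : 0 < M := by positivity
  refine ⟨2 * (k / 4), 2 * M, by positivity, by positivity, ?_⟩
  intro w _ hw
  set ε : ℝ := 1 - ‖w‖ ^ 2 with hε
  have he : 0 < ε := by nlinarith [norm_nonneg w]
  have he1 : ε ≤ 1 := by nlinarith [norm_nonneg w]
  have hwε : ‖w‖ ^ 2 = 1 - ε := by rw [hε]; ring
  have heα : 1 ≤ ε ^ α := Real.one_le_rpow_of_pos_of_le_one_of_nonpos he he1 hα₂.le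
  set L := ∫⁻ r in Set.Ioo (0 : ℝ) 1,
      ENNReal.ofReal (r ^ (β + 1) * (1 - r ^ 2) ^ α / (1 - (1 - ε) * r ^ 2)) with hL
  have hS : MeasurableSet {η : ℂ | η ≠ 0 ∧ ‖η‖ < 1} := PD_meas
  have hI : (∫ η in {η : ℂ | η ≠ 0 ∧ ‖η‖ < 1},
            (1 - ‖η‖ ^ 2) ^ α * ‖η‖ ^ β / ‖(1 : ℂ) - w * (starRingEnd ℂ) η‖ ^ 2
            ∂((ENNReal.ofReal Real.pi)⁻¹ • volume)) = 2 * L.toReal := by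
    rw [integral_eq_lintegral_of_nonneg_ae]
    · rw [Measure.restrict_smul, lintegral_smul_measure, PD_polar α β w hw, hwε, ← hL,
        smul_eq_mul, ENNReal.toReal_mul, ENNReal.toReal_mul, ENNReal.toReal_inv,
        ENNReal.toReal_ofReal hpi.le, ENNReal.toReal_ofReal (by positivity)]
      field_simp
    · rw [Filter.EventuallyLE, ae_restrict_iff' hS]
      refine Filter.Eventually.of_forall fun η hη => ?_
      have : 0 ≤ 1 - ‖η‖ ^ 2 := by nlinarith [norm_nonneg η, hη.2]
      simp only [Pi.zero_apply]
      positivity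
    · apply Measurable.aestronglyMeasurable
      have : Measurable (starRingEnd ℂ) := Complex.continuous_conj.measurable
      fun_prop
  have hup : L ≤ ENNReal.ofReal (M * ε ^ α) := by
    calc L ≤ ∫⁻ r in Set.Ioo (0 : ℝ) 1, (ENNReal.ofReal K1 * ENNReal.ofReal (r ^ (β + 1))
            + ENNReal.ofReal K2 * ENNReal.ofReal ((1 - r) ^ α / max (1 - r) ε)) := by
          apply setLIntegral_mono' measurableSet_Ioo
          intro r hr
          have hr' : 0 < 1 - r := by linarith [hr.2]
          have := hr.1
          have hmax : 0 < max (1 - r) ε := lt_max_of_lt_left hr'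
          rw [← ENNReal.ofReal_mul hK1p.le, ← ENNReal.ofReal_mul hK2p.le,
            ← ENNReal.ofReal_add (by positivity) (by positivity)]
          exact ENNReal.ofReal_le_ofReal (PD_pt_upper α β ε r hα₂ he he1 hr.1 hr.2)
      _ = ENNReal.ofReal K1 * (∫⁻ r in Set.Ioo (0 : ℝ) 1, ENNReal.ofReal (r ^ (β + 1)))
            + ENNReal.ofReal K2 * ∫⁻ r in Set.Ioo (0 : ℝ) 1,
              ENNReal.ofReal ((1 - r) ^ α / max (1 - r) ε) := by
          rw [lintegral_add_left (by fun_prop), lintegral_const_mul _ (by fun_prop),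
            lintegral_const_mul _ (by fun_prop)]
      _ ≤ ENNReal.ofReal K1 * ENNReal.ofReal (1 / (β + 2))
            + ENNReal.ofReal K2 * ENNReal.ofReal (ε ^ α * (1 / (α + 1) + 1 / (-α))) := by
          gcongr
          · refine (lintegral_mono_set Set.Ioo_subset_Ioc_self).trans ?_
            rw [PD_rpow (β + 1) 1 (by linarith) zero_le_one, Real.one_rpow]
            apply le_of_eq; congr 2; ring
          · exact PD_J α ε hα₁ hα₂ he he1
      _ ≤ ENNReal.ofReal (M * ε ^ α) := by
          rw [← ENNReal.ofReal_mul hK1p.le, ← ENNReal.ofReal_mul hK2p.le,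
            ← ENNReal.ofReal_add (by positivity) (by positivity)]
          apply ENNReal.ofReal_le_ofReal
          have : K1 * (1 / (β + 2)) * 1 ≤ K1 * (1 / (β + 2)) * ε ^ α := by gcongr
          rw [hM]
          linarith
  have hlow : ENNReal.ofReal (k / 4 * ε ^ α) ≤ L := by
    calc ENNReal.ofReal (k / 4 * ε ^ α)
        = ∫⁻ r in Set.Ioo (1 - ε / 2) 1, ENNReal.ofReal (k * ε ^ α / (2 * ε)) := by
          rw [setLIntegral_const, Real.volume_Ioo, ← ENNReal.ofReal_mul (by positivity)]
          congr 1
          field_simp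
          ring
      _ ≤ ∫⁻ r in Set.Ioo (1 - ε / 2) 1,
           ENNReal.ofReal (r ^ (β + 1) * (1 - r ^ 2) ^ α / (1 - (1 - ε) * r ^ 2)) := by
          apply setLIntegral_mono' measurableSet_Ioo
          intro r hr
          exact ENNReal.ofReal_le_ofReal (PD_pt_lower α β ε r hα₂ he he1 hr.1 hr.2)
      _ ≤ L := lintegral_mono_set (Set.Ioo_subset_Ioo_left (by linarith))
  have hfin : L ≠ ⊤ := ne_top_of_le_ne_top ENNReal.ofReal_ne_top hup
  have h1 := (ENNReal.ofReal_le_iff_le_toReal hfin).1 hlow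
  have h2 := ENNReal.toReal_le_of_le_ofReal (by positivity) hup
  rw [hI]
  constructor <;> linarith
end

section
/- Let −1 < α < 0 and −2 < β ≤ 0. Then there is a constant C > 0 such that for all w ∈ D*, ∫_{D*} (1−|η|²)^α |η|^β / |1 − w·conj(η)|² dV(η) ≤ C·(1−|w|²)^α·|w|^β. -/
open MeasureTheory

lemma aux_ang (a : ℂ) (ha : ‖a‖ < 1) :
    ∫⁻ θ in Set.Ioo (-Real.pi) Real.pi,
      ENNReal.ofReal (1 / ‖circleMap 0 1 θ - a‖ ^ 2) ≤
    ENNReal.ofReal (2 * Real.pi / (1 - ‖a‖ ^ 2)) := by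
  have hpos : 0 < 1 - ‖a‖ ^ 2 := by nlinarith [norm_nonneg a]
  have hne : ∀ θ : ℝ, circleMap 0 1 θ - a ≠ 0 := by
    intro θ h
    have h1 : ‖circleMap 0 1 θ‖ = 1 := by simp
    rw [sub_eq_zero.mp h] at h1
    linarith
  have hcont : Continuous (fun θ : ℝ => 1 / ‖circleMap 0 1 θ - a‖ ^ 2) := by
    refine continuous_const.div (by fun_prop) ?_
    intro θ
    exact pow_ne_zero _ (norm_ne_zero_iff.mpr (hne θ))
  have hP := DiffContOnCl.circleAverage_poissonKernel_smul' (f := fun _ : ℂ => (1 : ℂ)) (c := 0)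
    (R := 1) (w := a) diffContOnCl_const (by simpa using ha)
  have hI : ∫ θ in (0 : ℝ)..2 * Real.pi, 1 / ‖circleMap 0 1 θ - a‖ ^ 2
      = 2 * Real.pi / (1 - ‖a‖ ^ 2) := by
    rw [Real.circleAverage_def] at hP
    have h2 : ∀ θ : ℝ, ((‖circleMap 0 1 θ - 0‖ ^ 2 - ‖a - 0‖ ^ 2) /
        ‖circleMap 0 1 θ - 0 - (a - 0)‖ ^ 2) • (1 : ℂ)
        = (((1 - ‖a‖ ^ 2) * (1 / ‖circleMap 0 1 θ - a‖ ^ 2) : ℝ) : ℂ) := by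
      intro θ
      simp [div_eq_mul_inv]
    simp_rw [h2] at hP
    rw [intervalIntegral.integral_ofReal, intervalIntegral.integral_const_mul] at hP
    rw [Complex.real_smul] at hP
    have h3 : (2 * Real.pi)⁻¹ * ((1 - ‖a‖ ^ 2) *
      ∫ θ in (0 : ℝ)..2 * Real.pi, 1 / ‖circleMap 0 1 θ - a‖ ^ 2) = 1 := by exact_mod_cast hP
    rw [eq_div_iff hpos.ne']
    have := Real.pi_pos
    field_simp at h3
    linarith
  have hper : Function.Periodic (fun θ : ℝ => 1 / ‖circleMap 0 1 θ - a‖ ^ 2) (2 * Real.pi) := by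
    intro θ
    simp only [periodic_circleMap 0 1 θ]
  have hI2 := hper.intervalIntegral_add_eq (-Real.pi) 0
  rw [zero_add, hI, show -Real.pi + 2 * Real.pi = Real.pi by ring] at hI2
  rw [intervalIntegral.integral_of_le (by linarith [Real.pi_pos])] at hI2
  rw [← hI2, ofReal_integral_eq_lintegral_ofReal]
  · exact lintegral_mono_set Set.Ioo_subset_Ioc_self
  · exact (hcont.integrableOn_Icc).mono_set Set.Ioc_subset_Icc_self
  · exact Filter.Eventually.of_forall (fun θ => by positivity)

lemma aux_pow (c s : ℝ) (hc : -1 < c) (hs : 0 < s) :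
    ∫⁻ u in Set.Ioc 0 s, ENNReal.ofReal (u ^ c) = ENNReal.ofReal (s ^ (c + 1) / (c + 1)) := by
  have h := integral_rpow (a := 0) (b := s) (r := c) (Or.inl hc)
  rw [Real.zero_rpow (by linarith), sub_zero, intervalIntegral.integral_of_le hs.le] at h
  rw [← h, ofReal_integral_eq_lintegral_ofReal]
  · exact (intervalIntegral.intervalIntegrable_rpow' hc).1
  · filter_upwards [ae_restrict_mem measurableSet_Ioc] with x hx
    exact Real.rpow_nonneg hx.1.le _

lemma aux_tail (c s : ℝ) (hc : c < -1) (hs : 0 < s) :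
    ∫⁻ u in Set.Ioi s, ENNReal.ofReal (u ^ c) = ENNReal.ofReal (-s ^ (c + 1) / (c + 1)) := by
  rw [← integral_Ioi_rpow_of_lt hc hs, ofReal_integral_eq_lintegral_ofReal]
  · exact integrableOn_Ioi_rpow_of_lt hc hs
  · filter_upwards [ae_restrict_mem measurableSet_Ioi] with x hx
    exact Real.rpow_nonneg (hs.trans hx).le _

noncomputable def auxH (α s : ℝ) (u : ℝ) : ENNReal :=
  (Set.Ioc 0 s).indicator (fun u => ENNReal.ofReal s⁻¹ * ENNReal.ofReal (u ^ α)) u +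
  (Set.Ioi s).indicator (fun u => ENNReal.ofReal (u ^ (α - 1))) u

lemma auxH_meas (α s : ℝ) : Measurable (auxH α s) := by
  unfold auxH
  refine Measurable.add ?_ ?_
  · exact Measurable.indicator (by fun_prop) measurableSet_Ioc
  · exact Measurable.indicator (by fun_prop) measurableSet_Ioi

lemma auxH_int (α s : ℝ) (h1 : -1 < α) (h2 : α < 0) (hs : 0 < s) :
    ∫⁻ u, auxH α s u ≤ ENNReal.ofReal ((1 / (α + 1) + 1 / (-α)) * s ^ α) := by
  unfold auxH
  rw [lintegral_add_left (Measurable.indicator (by fun_prop) measurableSet_Ioc),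
    lintegral_indicator measurableSet_Ioc, lintegral_indicator measurableSet_Ioi,
    lintegral_const_mul _ (by fun_prop), aux_pow α s h1 hs, aux_tail (α - 1) s (by linarith) hs,
    ← ENNReal.ofReal_mul (by positivity), ← ENNReal.ofReal_add]
  · apply ENNReal.ofReal_le_ofReal
    rw [Real.rpow_add hs, Real.rpow_one, sub_add_cancel]
    apply le_of_eq
    have : α + 1 ≠ 0 := by linarith
    have : α ≠ 0 := h2.ne
    field_simp
  · have : 0 < α + 1 := by linarith
    positivity
  · rw [sub_add_cancel]
    exact div_nonneg_of_nonpos (by linarith [Real.rpow_nonneg hs.le α]) h2.le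

/-- pointwise bound of the radial integrand -/
lemma aux_pt (α β r ρ : ℝ) (h1 : -1 < α) (h2 : α < 0) (h3 : -2 < β) (h4 : β ≤ 0)
    (hr0 : 0 ≤ r) (hr : r < 1) (hρ0 : 0 < ρ) (hρ : ρ < 1) :
    ENNReal.ofReal (ρ * ((1 - ρ ^ 2) ^ α * ρ ^ β) / (1 - r ^ 2 * ρ ^ 2)) ≤
      ENNReal.ofReal ((1 / 2) ^ (α - 1)) * ENNReal.ofReal (ρ ^ (β + 1)) +
        2 * auxH α (1 - r ^ 2) (1 - ρ) := by
  have hu : 0 < 1 - ρ := by linarith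
  have hs : 0 < 1 - r ^ 2 := by nlinarith
  have hρ2 : ρ ^ 2 ≤ 1 := by nlinarith
  have hr2 : r ^ 2 ≤ 1 := by nlinarith
  have hd1 : 1 - ρ ≤ 1 - r ^ 2 * ρ ^ 2 := by nlinarith [mul_nonneg (sq_nonneg ρ) hs.le]
  have hd2 : 1 - r ^ 2 ≤ 1 - r ^ 2 * ρ ^ 2 := by nlinarith [sq_nonneg r]
  have hnum : ρ * ((1 - ρ ^ 2) ^ α * ρ ^ β) ≤ (1 - ρ) ^ α * ρ ^ (β + 1) := by
    rw [Real.rpow_add hρ0, Real.rpow_one]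
    have : (1 - ρ ^ 2) ^ α ≤ (1 - ρ) ^ α :=
      Real.rpow_le_rpow_of_nonpos hu (by nlinarith) h2.le
    have h5 : 0 ≤ ρ * ρ ^ β := by positivity
    nlinarith [mul_le_mul_of_nonneg_right this h5]
  have hp : 0 ≤ (1 - ρ) ^ α := by positivity
  have hq : 0 ≤ ρ ^ (β + 1) := by positivity
  have hmul : (1 - ρ) ^ α / (1 - ρ) = (1 - ρ) ^ (α - 1) := by
    rw [Real.rpow_sub hu, Real.rpow_one]
  rcases le_or_gt ρ (1 / 2) with hle | hgt
  · refine le_trans ?_ le_self_add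
    rw [← ENNReal.ofReal_mul (by positivity)]
    apply ENNReal.ofReal_le_ofReal
    calc _ ≤ (1 - ρ) ^ α * ρ ^ (β + 1) / (1 - ρ) := by gcongr
      _ = (1 - ρ) ^ (α - 1) * ρ ^ (β + 1) := by rw [← hmul]; ring
      _ ≤ _ := by
        gcongr ?_ * _
        exact Real.rpow_le_rpow_of_nonpos (by norm_num) (by linarith) (by linarith)
  · refine le_trans ?_ le_add_self
    have hq2 : ρ ^ (β + 1) ≤ 2 := by
      calc ρ ^ (β + 1) ≤ ρ ^ (-1 : ℝ) :=
            Real.rpow_le_rpow_of_exponent_ge hρ0 hρ.le (by linarith)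
        _ ≤ (1 / 2 : ℝ) ^ (-1 : ℝ) :=
            Real.rpow_le_rpow_of_nonpos (by norm_num) hgt.le (by norm_num)
        _ = 2 := by rw [Real.rpow_neg_one]; norm_num
    have hnum2 : ρ * ((1 - ρ ^ 2) ^ α * ρ ^ β) ≤ 2 * (1 - ρ) ^ α := by nlinarith
    have h2e : (2 : ENNReal) = ENNReal.ofReal 2 := by simp
    unfold auxH
    rcases le_or_gt (1 - ρ) (1 - r ^ 2) with hc | hc
    · rw [Set.indicator_of_mem (show 1 - ρ ∈ Set.Ioc 0 (1 - r ^ 2) from ⟨hu, hc⟩),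
        Set.indicator_of_notMem (show 1 - ρ ∉ Set.Ioi (1 - r ^ 2) from not_lt.mpr hc), add_zero, h2e,
        ← ENNReal.ofReal_mul (by positivity), ← ENNReal.ofReal_mul (by positivity)]
      apply ENNReal.ofReal_le_ofReal
      calc _ ≤ 2 * (1 - ρ) ^ α / (1 - r ^ 2) := by gcongr
        _ = _ := by ring
    · rw [Set.indicator_of_notMem (fun h => absurd h.2 (not_le.mpr hc)),
        Set.indicator_of_mem (show 1 - ρ ∈ Set.Ioi (1 - r ^ 2) from hc), zero_add, h2e,
        ← ENNReal.ofReal_mul (by positivity)]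
      apply ENNReal.ofReal_le_ofReal
      calc _ ≤ 2 * (1 - ρ) ^ α / (1 - ρ) := by gcongr
        _ = _ := by rw [← hmul]; ring

lemma aux_rad (α β : ℝ) (h1 : -1 < α) (h2 : α < 0) (h3 : -2 < β) (h4 : β ≤ 0) :
    ∃ C : ℝ, 0 < C ∧ ∀ r : ℝ, 0 ≤ r → r < 1 →
      ∫⁻ ρ in Set.Ioo 0 1,
        ENNReal.ofReal (ρ * ((1 - ρ ^ 2) ^ α * ρ ^ β) / (1 - r ^ 2 * ρ ^ 2)) ≤
      ENNReal.ofReal (C * (1 - r ^ 2) ^ α) := by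
  have hA : 0 < 1 / (α + 1) + 1 / (-α) := by
    have : 0 < α + 1 := by linarith
    have : 0 < -α := by linarith
    positivity
  have hB : 0 < (1 / 2 : ℝ) ^ (α - 1) * (1 / (β + 2)) := by
    have : 0 < β + 2 := by linarith
    positivity
  refine ⟨(1 / 2 : ℝ) ^ (α - 1) * (1 / (β + 2)) + 2 * (1 / (α + 1) + 1 / (-α)),
    by positivity, ?_⟩
  intro r hr0 hr
  have hs : 0 < 1 - r ^ 2 := by nlinarith
  have hs1 : 1 ≤ (1 - r ^ 2) ^ α :=
    Real.one_le_rpow_of_pos_of_le_one_of_nonpos hs (by nlinarith [sq_nonneg r]) h2.le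
  have hm : Measurable (fun ρ : ℝ => auxH α (1 - r ^ 2) (1 - ρ)) :=
    (auxH_meas _ _).comp (by fun_prop)
  calc _ ≤ ∫⁻ ρ in Set.Ioo (0 : ℝ) 1,
          (ENNReal.ofReal ((1 / 2) ^ (α - 1)) * ENNReal.ofReal (ρ ^ (β + 1)) +
            2 * auxH α (1 - r ^ 2) (1 - ρ)) := by
        refine setLIntegral_mono' measurableSet_Ioo fun ρ hρ => ?_
        exact aux_pt α β r ρ h1 h2 h3 h4 hr0 hr hρ.1 hρ.2
    _ = ENNReal.ofReal ((1 / 2) ^ (α - 1)) *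
          (∫⁻ ρ in Set.Ioo (0 : ℝ) 1, ENNReal.ofReal (ρ ^ (β + 1))) +
          2 * ∫⁻ ρ in Set.Ioo (0 : ℝ) 1, auxH α (1 - r ^ 2) (1 - ρ) := by
        rw [lintegral_add_left (by fun_prop), lintegral_const_mul _ (by fun_prop),
          lintegral_const_mul _ hm]
    _ ≤ ENNReal.ofReal ((1 / 2) ^ (α - 1)) *
          (∫⁻ ρ in Set.Ioc (0 : ℝ) 1, ENNReal.ofReal (ρ ^ (β + 1))) +
          2 * ∫⁻ ρ, auxH α (1 - r ^ 2) (1 - ρ) := by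
        gcongr
        · exact Set.Ioo_subset_Ioc_self
        · exact Measure.restrict_le_self
    _ ≤ ENNReal.ofReal ((1 / 2) ^ (α - 1)) * ENNReal.ofReal (1 / (β + 2)) +
          ENNReal.ofReal 2 * ENNReal.ofReal ((1 / (α + 1) + 1 / (-α)) * (1 - r ^ 2) ^ α) := by
        rw [lintegral_sub_left_eq_self (auxH α (1 - r ^ 2)) 1,
          aux_pow (β + 1) 1 (by linarith) one_pos, Real.one_rpow,
          show β + 1 + 1 = β + 2 by ring, show ENNReal.ofReal 2 = 2 by simp]
        gcongr
        exact auxH_int α _ h1 h2 hs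
    _ ≤ _ := by
        rw [← ENNReal.ofReal_mul (by positivity), ← ENNReal.ofReal_mul (by positivity),
          ← ENNReal.ofReal_add hB.le (by positivity)]
        apply ENNReal.ofReal_le_ofReal
        nlinarith

lemma aux_main (α β : ℝ) (w : ℂ) (hw : ‖w‖ < 1) :
    ∫⁻ η in {η : ℂ | η ≠ 0 ∧ ‖η‖ < 1},
      ENNReal.ofReal ((1 - ‖η‖ ^ 2) ^ α * ‖η‖ ^ β / ‖(1 : ℂ) - w * (starRingEnd ℂ) η‖ ^ 2) ≤
    ENNReal.ofReal (2 * Real.pi) * ∫⁻ ρ in Set.Ioo 0 1,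
        ENNReal.ofReal (ρ * ((1 - ρ ^ 2) ^ α * ρ ^ β) / (1 - ‖w‖ ^ 2 * ρ ^ 2)) := by
  have hS : MeasurableSet {η : ℂ | η ≠ 0 ∧ ‖η‖ < 1} := by
    apply MeasurableSet.inter
    · exact (measurableSet_singleton (0 : ℂ)).compl
    · exact measurableSet_lt measurable_norm measurable_const
  have hF : Measurable (fun η : ℂ => ENNReal.ofReal
      ((1 - ‖η‖ ^ 2) ^ α * ‖η‖ ^ β / ‖(1 : ℂ) - w * (starRingEnd ℂ) η‖ ^ 2)) := by
    have : Measurable (fun η : ℂ => (starRingEnd ℂ) η) := Complex.continuous_conj.measurable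
    fun_prop
  rw [← lintegral_indicator hS, ← Complex.lintegral_comp_polarCoord_symm, polarCoord_target,
    Measure.volume_eq_prod, ← Measure.prod_restrict]
  refine (lintegral_prod_le _).trans ?_
  rw [← lintegral_const_mul' _ _ ENNReal.ofReal_ne_top, ← lintegral_indicator measurableSet_Ioo,
    ← lintegral_indicator measurableSet_Ioi]
  refine lintegral_mono fun ρ => ?_
  by_cases h0 : 0 < ρ
  swap
  · rw [Set.indicator_of_notMem (by simpa using h0)]
    exact zero_le
  rw [Set.indicator_of_mem (show ρ ∈ Set.Ioi 0 from h0)]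
  have hsym : ∀ θ : ℝ, Complex.polarCoord.symm (ρ, θ) = ρ * circleMap 0 1 θ := by
    intro θ
    simp [circleMap, Complex.exp_mul_I]
  have hnorm : ∀ θ : ℝ, ‖(ρ : ℂ) * circleMap 0 1 θ‖ = ρ := by
    intro θ
    simp [abs_of_pos h0]
  by_cases hρ1 : ρ < 1
  swap
  · rw [Set.indicator_of_notMem (fun h => hρ1 h.2)]
    refine le_of_eq ?_
    have : ∀ θ : ℝ, ENNReal.ofReal (ρ, θ).1 • ({η : ℂ | η ≠ 0 ∧ ‖η‖ < 1}).indicator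
        (fun η : ℂ => ENNReal.ofReal ((1 - ‖η‖ ^ 2) ^ α * ‖η‖ ^ β /
          ‖(1 : ℂ) - w * (starRingEnd ℂ) η‖ ^ 2)) (Complex.polarCoord.symm (ρ, θ)) = 0 := by
      intro θ
      rw [Set.indicator_of_notMem, smul_zero]
      rintro ⟨-, h⟩
      rw [hsym, hnorm] at h
      exact hρ1 h
    simp_rw [this]
    simp
  rw [Set.indicator_of_mem (show ρ ∈ Set.Ioo 0 1 from ⟨h0, hρ1⟩)]
  have hden : ∀ θ : ℝ, ‖(1 : ℂ) - w * (starRingEnd ℂ) (ρ * circleMap 0 1 θ)‖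
      = ‖circleMap 0 1 θ - w * ρ‖ := by
    intro θ
    have hz : ‖circleMap 0 1 θ‖ = 1 := by simp
    have hzz : circleMap 0 1 θ * (starRingEnd ℂ) (circleMap 0 1 θ) = 1 := by
      rw [Complex.mul_conj, Complex.normSq_eq_norm_sq, hz]; simp
    calc _ = ‖circleMap 0 1 θ‖ * ‖(1 : ℂ) - w * (starRingEnd ℂ) (ρ * circleMap 0 1 θ)‖ := by
          rw [hz, one_mul]
      _ = _ := by
          rw [← norm_mul]
          congr 1
          rw [map_mul, Complex.conj_ofReal]
          linear_combination (-w * ρ) * hzz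
  have hd0 : 0 ≤ 1 - ρ ^ 2 := by nlinarith
  have this : ∀ θ : ℝ, ENNReal.ofReal (ρ, θ).1 • ({η : ℂ | η ≠ 0 ∧ ‖η‖ < 1}).indicator
        (fun η : ℂ => ENNReal.ofReal ((1 - ‖η‖ ^ 2) ^ α * ‖η‖ ^ β /
          ‖(1 : ℂ) - w * (starRingEnd ℂ) η‖ ^ 2)) (Complex.polarCoord.symm (ρ, θ))
        = ENNReal.ofReal (ρ * ((1 - ρ ^ 2) ^ α * ρ ^ β)) *
          ENNReal.ofReal (1 / ‖circleMap 0 1 θ - w * ρ‖ ^ 2) := by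
    intro θ
    rw [hsym, Set.indicator_of_mem]
    · rw [hnorm, hden, smul_eq_mul, ← ENNReal.ofReal_mul h0.le,
        ← ENNReal.ofReal_mul (by positivity)]
      congr 1
      ring
    · refine ⟨?_, ?_⟩
      · rw [← norm_ne_zero_iff, hnorm]; exact h0.ne'
      · rw [hnorm]; exact hρ1
  simp_rw [this]
  rw [lintegral_const_mul' _ _ ENNReal.ofReal_ne_top]
  have hn : ‖w * (ρ : ℂ)‖ = ‖w‖ * ρ := by simp [abs_of_pos h0]
  have hlt : ‖w * (ρ : ℂ)‖ < 1 := by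
    rw [hn]; nlinarith [norm_nonneg w]
  have hang := aux_ang (w * ρ) hlt
  calc _ ≤ ENNReal.ofReal (ρ * ((1 - ρ ^ 2) ^ α * ρ ^ β)) *
        ENNReal.ofReal (2 * Real.pi / (1 - ‖w * (ρ : ℂ)‖ ^ 2)) := by gcongr
    _ = _ := by
      rw [← ENNReal.ofReal_mul (by positivity), ← ENNReal.ofReal_mul (by positivity), hn]
      congr 1
      ring

/-- For -1 < α < 0 and -2 < β ≤ 0, the integral
I_{α,β}(w) = ∫_{D*} (1-|η|²)^α |η|^β / |1-w·conj η|² dV(η)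
(with dV the area measure normalized so V(D*) = 1) is ≲ (1-|w|²)^α |w|^β on D*. -/
theorem integral_punctured_disk_kernel_upper_estimate (α β : ℝ)
    (hα₁ : -1 < α) (hα₂ : α < 0) (hβ₁ : -2 < β) (hβ₂ : β ≤ 0) :
    ∃ C : ℝ, 0 < C ∧
      ∀ w : ℂ, w ≠ 0 → ‖w‖ < 1 →
        (∫ η in {η : ℂ | η ≠ 0 ∧ ‖η‖ < 1},
            (1 - ‖η‖ ^ 2) ^ α * ‖η‖ ^ β / ‖(1 : ℂ) - w * (starRingEnd ℂ) η‖ ^ 2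
            ∂((ENNReal.ofReal Real.pi)⁻¹ • volume)) ≤
          C * ((1 - ‖w‖ ^ 2) ^ α * ‖w‖ ^ β) := by
  obtain ⟨C, hC, hrad⟩ := aux_rad α β hα₁ hα₂ hβ₁ hβ₂
  refine ⟨2 * C, by positivity, ?_⟩
  intro w hw0 hw
  have hwp : 0 < ‖w‖ := norm_pos_iff.mpr hw0
  have hs : 0 < 1 - ‖w‖ ^ 2 := by nlinarith
  have hβ : 1 ≤ ‖w‖ ^ β := Real.one_le_rpow_of_pos_of_le_one_of_nonpos hwp hw.le hβ₂
  have hsα : 0 < (1 - ‖w‖ ^ 2) ^ α := by positivity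
  have hpi := Real.pi_pos
  rw [Measure.restrict_smul, integral_smul_measure, ENNReal.toReal_inv,
    ENNReal.toReal_ofReal hpi.le, smul_eq_mul]
  have key : (∫ η in {η : ℂ | η ≠ 0 ∧ ‖η‖ < 1},
      (1 - ‖η‖ ^ 2) ^ α * ‖η‖ ^ β / ‖(1 : ℂ) - w * (starRingEnd ℂ) η‖ ^ 2) ≤
      2 * Real.pi * (C * (1 - ‖w‖ ^ 2) ^ α) := by
    have hL := (aux_main α β w hw).trans
      (mul_le_mul_right (hrad ‖w‖ hwp.le hw) (ENNReal.ofReal (2 * Real.pi)))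
    rw [← ENNReal.ofReal_mul (by positivity)] at hL
    have hS : MeasurableSet {η : ℂ | η ≠ 0 ∧ ‖η‖ < 1} := by
      apply MeasurableSet.inter
      · exact (measurableSet_singleton (0 : ℂ)).compl
      · exact measurableSet_lt measurable_norm measurable_const
    rw [integral_eq_lintegral_of_nonneg_ae]
    · exact ENNReal.toReal_le_of_le_ofReal (by positivity) hL
    · filter_upwards [ae_restrict_mem hS] with η hη
      have h1 : 0 ≤ 1 - ‖η‖ ^ 2 := by nlinarith [hη.2, norm_nonneg η]
      simp only [Pi.zero_apply]
      positivity
    · have : Measurable (fun η : ℂ => (starRingEnd ℂ) η) := Complex.continuous_conj.measurable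
      apply Measurable.aestronglyMeasurable
      fun_prop
  calc _ ≤ Real.pi⁻¹ * (2 * Real.pi * (C * (1 - ‖w‖ ^ 2) ^ α)) := by gcongr
    _ = 2 * C * ((1 - ‖w‖ ^ 2) ^ α * 1) := by field_simp
    _ ≤ _ := by gcongr
end
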